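/- Let s, K, σ, τ > 0, r ∈ ℝ and dividend rate q ≥ 0. Define d₁ = (log(s/K) + (r − q + σ²/2)τ)/(σ√τ) and d₂ = d₁ − σ√τ. Then e^{−rτ} · (2π)^{−1/2} ∫_ℝ max(s·exp((r − q − σ²/2)τ + σ√τ·z) − K, 0) · e^{−z²/2} dz = s·e^{−qτ}·Φ(d₁) − K·e^{−rτ}·Φ(d₂) (the Black–Scholes formula for a call option on a stock paying a continuous dividend rate q). -/

import Mathlib

open Real MeasureTheory

/-- The standard normal cumulative distribution function. -/
noncomputable def Phi (x : ℝ) : ℝ :=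
  (Real.sqrt (2 * Real.pi))⁻¹ * ∫ y in Set.Iio x, Real.exp (-(y ^ 2) / 2)

/-- The Gaussian weight `exp (-y² / 2)` is integrable. -/
lemma integrable_exp_neg_sq_div_two : Integrable fun y : ℝ => Real.exp (-(y ^ 2) / 2) := by
  convert integrable_exp_neg_mul_sq (show (0 : ℝ) < 1 / 2 by norm_num) using 3
  ring

/-- The truncated Gaussian weight, reflected and translated, is integrable. -/
lemma integrable_indicator_gaussian_sub (a d : ℝ) :
    Integrable fun z : ℝ =>
      (Set.Iio d).indicator (fun y => Real.exp (-(y ^ 2) / 2)) (a - z) :=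
  (integrable_exp_neg_sq_div_two.indicator measurableSet_Iio).comp_sub_left a

/-- The integral of the truncated Gaussian weight is invariant under `z ↦ a - z`. -/
lemma integral_indicator_gaussian_sub (a d : ℝ) :
    ∫ z : ℝ, (Set.Iio d).indicator (fun y => Real.exp (-(y ^ 2) / 2)) (a - z)
      = ∫ y in Set.Iio d, Real.exp (-(y ^ 2) / 2) := by
  rw [integral_sub_left_eq_self
      ((Set.Iio d).indicator fun y : ℝ => Real.exp (-(y ^ 2) / 2)) volume a,
    integral_indicator measurableSet_Iio]

/-- The call payoff against the Gaussian weight, split into its asset and cash parts, when the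
option is at the money at `z = -d`. -/
lemma max_sub_mul_gaussian_eq {s K μ a d : ℝ} (hs : 0 < s) (ha : 0 < a)
    (hd : s * Real.exp (μ - a * d) = K) (z : ℝ) :
    max (s * Real.exp (μ + a * z) - K) 0 * Real.exp (-(z ^ 2) / 2)
      = s * Real.exp (μ + a ^ 2 / 2) *
          (Set.Iio (d + a)).indicator (fun y => Real.exp (-(y ^ 2) / 2)) (a - z)
        - K * (Set.Iio d).indicator (fun y => Real.exp (-(y ^ 2) / 2)) (0 - z) := by
  by_cases hz : -z < d
  · have hexp : Real.exp (μ - a * d) ≤ Real.exp (μ + a * z) :=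
      Real.exp_le_exp.2 (by nlinarith)
    have hle : 0 ≤ s * Real.exp (μ + a * z) - K := by
      rw [← hd]
      exact sub_nonneg.2 (mul_le_mul_of_nonneg_left hexp hs.le)
    have hweight : Real.exp (μ + a ^ 2 / 2) * Real.exp (-((a - z) ^ 2) / 2)
        = Real.exp (μ + a * z) * Real.exp (-(z ^ 2) / 2) := by
      rw [← Real.exp_add, ← Real.exp_add]
      ring_nf
    rw [max_eq_left hle, Set.indicator_of_mem (Set.mem_Iio.2 (by linarith)),
      Set.indicator_of_mem (Set.mem_Iio.2 (by linarith)), mul_assoc s, hweight,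
      zero_sub, neg_sq]
    ring
  · have hexp : Real.exp (μ + a * z) ≤ Real.exp (μ - a * d) :=
      Real.exp_le_exp.2 (by nlinarith)
    have hle : s * Real.exp (μ + a * z) - K ≤ 0 := by
      rw [← hd]
      exact sub_nonpos.2 (mul_le_mul_of_nonneg_left hexp hs.le)
    rw [max_eq_right hle,
      Set.indicator_of_notMem (fun h => hz (by linarith [Set.mem_Iio.1 h])),
      Set.indicator_of_notMem (fun h => hz (by linarith [Set.mem_Iio.1 h]))]
    ring

/-- The Black–Scholes formula for a call option on a stock paying a continuous dividend
rate `q`: the price equals `s·e^{−qτ}·Φ(d₁) − K·e^{−rτ}·Φ(d₂)`. -/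
theorem black_scholes_call_formula_dividends
    (s K σ τ r q : ℝ) (hs : 0 < s) (hK : 0 < K) (hσ : 0 < σ) (hτ : 0 < τ) (hq : 0 ≤ q)
    (d₁ d₂ : ℝ)
    (hd₁ : d₁ = (Real.log (s / K) + (r - q + σ ^ 2 / 2) * τ) / (σ * Real.sqrt τ))
    (hd₂ : d₂ = d₁ - σ * Real.sqrt τ) :
    Real.exp (-r * τ) * (Real.sqrt (2 * Real.pi))⁻¹ *
        (∫ z : ℝ, max (s * Real.exp ((r - q - σ ^ 2 / 2) * τ + σ * Real.sqrt τ * z) - K) 0 *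
          Real.exp (-(z ^ 2) / 2))
      = s * Real.exp (-q * τ) * Phi d₁ - K * Real.exp (-r * τ) * Phi d₂ := by
  have ha : 0 < σ * Real.sqrt τ := mul_pos hσ (Real.sqrt_pos.2 hτ)
  have hsq : (σ * Real.sqrt τ) ^ 2 = σ ^ 2 * τ := by rw [mul_pow, Real.sq_sqrt hτ.le]
  have had₁ : σ * Real.sqrt τ * d₁ = Real.log (s / K) + (r - q + σ ^ 2 / 2) * τ := by
    rw [hd₁, mul_div_cancel₀ _ ha.ne']
  have hstrike : s * Real.exp ((r - q - σ ^ 2 / 2) * τ - σ * Real.sqrt τ * d₂) = K := by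
    have hlog : (r - q - σ ^ 2 / 2) * τ - σ * Real.sqrt τ * d₂ = -Real.log (s / K) := by
      rw [hd₂]
      linear_combination hsq - had₁
    rw [hlog, Real.exp_neg, Real.exp_log (div_pos hs hK)]
    field_simp
  have hdisc : Real.exp (-r * τ) *
      Real.exp ((r - q - σ ^ 2 / 2) * τ + (σ * Real.sqrt τ) ^ 2 / 2) = Real.exp (-q * τ) := by
    rw [hsq, ← Real.exp_add]
    ring_nf
  have hd : d₂ + σ * Real.sqrt τ = d₁ := by rw [hd₂, sub_add_cancel]
  simp_rw [max_sub_mul_gaussian_eq hs ha hstrike]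
  rw [integral_sub ((integrable_indicator_gaussian_sub _ _).const_mul _)
      ((integrable_indicator_gaussian_sub _ _).const_mul _),
    integral_const_mul, integral_const_mul, integral_indicator_gaussian_sub,
    integral_indicator_gaussian_sub, hd, ← hdisc, Phi, Phi]
  ring
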